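/- For an even integer n = 2m with m ≥ 2, in the group G with presentation ⟨r₀, r₁, r₂ ∣ r₀² = r₁² = r₂² = (r₀r₁)ⁿ = (r₂r₀)² = (r₁r₂)ⁿ = (r₀r₁r₂)² = 1⟩ (a group of order 4n), the centraliser of the element a = r₀r₁r₂ has order 8. (Consequently the quotient map M = {n,n}₂/⟨a⟩ has |Aut M| = 4 while |Aut M̃| = 8m, so M is unstable for every m ≥ 2.) -/

import Mathlib

/-- The relations r₀² = r₁² = r₂² = (r₀r₁)ⁿ = (r₂r₀)² = (r₁r₂)ⁿ = (r₀r₁r₂)² = 1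
presenting the automorphism group of the regular orientable map {n,n}₂. -/
def nnRels (n : ℕ) : Set (FreeGroup (Fin 3)) :=
  {FreeGroup.of 0 ^ 2, FreeGroup.of 1 ^ 2, FreeGroup.of 2 ^ 2,
    (FreeGroup.of 0 * FreeGroup.of 1) ^ n,
    (FreeGroup.of 2 * FreeGroup.of 0) ^ 2,
    (FreeGroup.of 1 * FreeGroup.of 2) ^ n,
    (FreeGroup.of 0 * FreeGroup.of 1 * FreeGroup.of 2) ^ 2}

/-- The automorphism group G of the regular orientable map {n,n}₂. -/
abbrev NNGroup (n : ℕ) := PresentedGroup (nnRels n)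

/-- The generators rᵢ of G. -/
def r (n : ℕ) (i : Fin 3) : NNGroup n := PresentedGroup.of i

/-- The homomorphism from the cyclic group of order `n` sending the generator to an element `x`
with `x ^ n = 1`. -/
def zmodPowersHom {H : Type*} [Group H] (n : ℕ) (x : H) (hx : x ^ n = 1) :
    Multiplicative (ZMod n) →* H :=
  AddMonoidHom.toMultiplicativeLeft
    (ZMod.lift n ⟨zmultiplesHom (Additive H) (Additive.ofMul x), by
      simpa [← ofMul_pow] using hx⟩)

theorem zmodPowersHom_ofAdd_intCast {H : Type*} [Group H] (n : ℕ) (x : H) (hx : x ^ n = 1)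
    (k : ℤ) : zmodPowersHom n x hx (Multiplicative.ofAdd (k : ZMod n)) = x ^ k := by
  simp [zmodPowersHom, ZMod.lift_coe]

theorem zmodPowersHom_ofAdd_one {H : Type*} [Group H] (n : ℕ) (x : H) (hx : x ^ n = 1) :
    zmodPowersHom n x hx (Multiplicative.ofAdd 1) = x := by
  simpa using zmodPowersHom_ofAdd_intCast n x hx 1

namespace DihedralGroup

/-- The homomorphism from a dihedral group determined by the images `x` of the rotation `r 1`
and `s` of the reflection `sr 0`. -/
def lift {H : Type*} [Group H] (n : ℕ) (s x : H) (hs : s * s = 1) (hx : x ^ n = 1)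
    (hsx : s * x * s⁻¹ = x⁻¹) : DihedralGroup n →* H :=
  MonoidHom.mk'
    (fun g => match g with
      | .r i => zmodPowersHom n x hx (Multiplicative.ofAdd i)
      | .sr i => s * zmodPowersHom n x hx (Multiplicative.ofAdd i))
    (by
      have key : ∀ i : ZMod n, zmodPowersHom n x hx (Multiplicative.ofAdd i) * s
          = s * (zmodPowersHom n x hx (Multiplicative.ofAdd i))⁻¹ := by
        intro i
        obtain ⟨k, rfl⟩ := ZMod.intCast_surjective i
        have hk : s * x ^ k * s⁻¹ = (x ^ k)⁻¹ := by rw [← conj_zpow, hsx, inv_zpow]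
        rw [zmodPowersHom_ofAdd_intCast, ← hk, ← mul_assoc, ← mul_assoc, hs, one_mul,
          inv_eq_of_mul_eq_one_right hs]
      rintro (i | i) (j | j)
      · simp [ofAdd_add]
      · simp only [r_mul_sr, sub_eq_neg_add, ofAdd_add, ofAdd_neg, map_mul, map_inv]
        rw [← mul_assoc _ s, key, mul_assoc]
      · simp [ofAdd_add, mul_assoc]
      · simp only [sr_mul_sr, sub_eq_neg_add, ofAdd_add, ofAdd_neg, map_mul, map_inv]
        rw [mul_assoc s, ← mul_assoc _ s, key, mul_assoc s, ← mul_assoc s s, hs, one_mul])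

theorem lift_r {H : Type*} [Group H] (n : ℕ) (s x : H) (hs : s * s = 1) (hx : x ^ n = 1)
    (hsx : s * x * s⁻¹ = x⁻¹) (k : ℤ) : lift n s x hs hx hsx (.r k) = x ^ k :=
  zmodPowersHom_ofAdd_intCast n x hx k

theorem lift_sr {H : Type*} [Group H] (n : ℕ) (s x : H) (hs : s * s = 1) (hx : x ^ n = 1)
    (hsx : s * x * s⁻¹ = x⁻¹) (k : ℤ) : lift n s x hs hx hsx (.sr k) = s * x ^ k :=
  congrArg (s * ·) (zmodPowersHom_ofAdd_intCast n x hx k)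

end DihedralGroup

theorem ZMod.add_self_eq_zero_iff {m : ℕ} (hm : m ≠ 0) (x : ZMod (2 * m)) :
    x + x = 0 ↔ x = 0 ∨ x = m := by
  have : NeZero (2 * m) := ⟨by omega⟩
  constructor
  · intro h
    obtain ⟨k, hk, rfl⟩ : ∃ k < 2 * m, (k : ZMod (2 * m)) = x :=
      ⟨x.val, x.val_lt, ZMod.natCast_zmod_val x⟩
    rw [← Nat.cast_add, ZMod.natCast_eq_zero_iff, ← two_mul,
      Nat.mul_dvd_mul_iff_left two_pos] at h
    obtain ⟨c, rfl⟩ := h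
    have hc : c < 2 := by
      by_contra! hc
      nlinarith
    interval_cases c <;> simp
  · rintro (rfl | rfl)
    · simp
    · rw [← Nat.cast_add, ← two_mul, ZMod.natCast_self]

theorem DihedralGroup.card_centralizer_sr {m : ℕ} (hm : m ≠ 0) (i : ZMod (2 * m)) :
    Nat.card (Subgroup.centralizer {DihedralGroup.sr i}) = 4 := by
  have hm0 : (m : ZMod (2 * m)) ≠ 0 := by
    rw [Ne, ZMod.natCast_eq_zero_iff]
    exact fun h => absurd (Nat.le_of_dvd (by omega) h) (by omega)
  have hC : (Subgroup.centralizer {DihedralGroup.sr i} : Set (DihedralGroup (2 * m)))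
      = (({.r 0, .r m, .sr i, .sr (i + m)} : Finset (DihedralGroup (2 * m))) : Set _) := by
    ext g
    rw [SetLike.mem_coe, Subgroup.mem_centralizer_singleton_iff]
    rcases g with j | j
    · have h : i + j = i - j ↔ j + j = 0 := by grind
      simp [-DihedralGroup.r_zero, eq_comm (a := i - j), h, ZMod.add_self_eq_zero_iff hm]
    · have h : i - j = j - i ↔ (j - i) + (j - i) = 0 := by grind
      simp [-DihedralGroup.r_zero, h, ZMod.add_self_eq_zero_iff hm,
        sub_eq_iff_eq_add, add_comm]
  rw [← SetLike.coe_sort_coe, Nat.card_coe_set_eq, hC, Set.ncard_coe_finset]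
  simp [-DihedralGroup.r_zero, Finset.card_insert_of_notMem, hm0, hm0.symm]

theorem Subgroup.card_centralizer_prod_one {A B : Type*} [Group A] [Group B] (a : A) :
    Nat.card (Subgroup.centralizer {((a, 1) : A × B)})
      = Nat.card (Subgroup.centralizer {a}) * Nat.card B := by
  have h : Subgroup.centralizer {((a, 1) : A × B)} = (Subgroup.centralizer {a}).prod ⊤ := by
    ext ⟨x, y⟩
    simp [Subgroup.mem_prod, Subgroup.mem_centralizer_singleton_iff]
  rw [h, Nat.card_congr (Subgroup.prodEquiv _ _).toEquiv, Nat.card_prod, Subgroup.card_top]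

theorem MulEquiv.card_centralizer_singleton {A B : Type*} [Group A] [Group B] (f : A ≃* B)
    (a : A) : Nat.card (Subgroup.centralizer {a}) = Nat.card (Subgroup.centralizer {f a}) := by
  refine Nat.card_congr (f.toEquiv.subtypeEquiv fun x => ?_)
  simp only [Subgroup.mem_centralizer_singleton_iff, MulEquiv.toEquiv_eq_coe,
    MulEquiv.coe_toEquiv, ← map_mul, f.injective.eq_iff]

section Relations

variable (n : ℕ)

theorem r_mul_self (i : Fin 3) : r n i * r n i = 1 := by
  rw [← pow_two]
  fin_cases i <;>
    exact PresentedGroup.one_of_mem (rels := nnRels n) (by simp [nnRels])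

theorem r_inv (i : Fin 3) : (r n i)⁻¹ = r n i :=
  inv_eq_of_mul_eq_one_right (r_mul_self n i)

theorem r_one_mul_r_two_pow : (r n 1 * r n 2) ^ n = 1 :=
  PresentedGroup.one_of_mem (rels := nnRels n) (x := (.of 1 * .of 2) ^ n) (by simp [nnRels])

theorem r_zero_comm_r_two : r n 0 * r n 2 = r n 2 * r n 0 := by
  have h : (r n 2 * r n 0) ^ 2 = 1 :=
    PresentedGroup.one_of_mem (rels := nnRels n) (x := (.of 2 * .of 0) ^ 2) (by simp [nnRels])
  rw [pow_two] at h
  simpa [r_inv] using inv_eq_of_mul_eq_one_right h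

theorem r_zero_mul_r_one_mul_r_two_inv :
    (r n 0 * r n 1 * r n 2)⁻¹ = r n 0 * r n 1 * r n 2 := by
  have h : (r n 0 * r n 1 * r n 2) ^ 2 = 1 :=
    PresentedGroup.one_of_mem (rels := nnRels n) (x := (.of 0 * .of 1 * .of 2) ^ 2)
      (by simp [nnRels])
  exact inv_eq_of_mul_eq_one_right (by rwa [pow_two] at h)

theorem commute_r_zero_mul_r_two_r (i : Fin 3) : Commute (r n 0 * r n 2) (r n i) := by
  have h0 := r_mul_self n 0
  have h := r_zero_comm_r_two n
  have ha := r_zero_mul_r_one_mul_r_two_inv n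
  simp only [mul_inv_rev, r_inv] at ha
  rw [commute_iff_eq]
  fin_cases i
  · change r n 0 * r n 2 * r n 0 = r n 0 * (r n 0 * r n 2)
    rw [h, mul_assoc, h0, ← h, ← mul_assoc, h0, one_mul, mul_one]
  · change r n 0 * r n 2 * r n 1 = r n 1 * (r n 0 * r n 2)
    calc r n 0 * r n 2 * r n 1 = r n 0 * (r n 2 * (r n 1 * r n 0)) * r n 0 := by
          simp [mul_assoc, h0]
      _ = r n 1 * (r n 0 * r n 2) := by
          rw [ha, h, mul_assoc, mul_assoc, mul_assoc, ← mul_assoc, h0, one_mul]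
  · change r n 0 * r n 2 * r n 2 = r n 2 * (r n 0 * r n 2)
    rw [h, ← mul_assoc, mul_assoc (r n 2), mul_assoc (r n 2), h]

theorem commute_r_zero_mul_r_two (g : NNGroup n) : Commute (r n 0 * r n 2) g :=
  (Subgroup.mem_centralizer_singleton_iff.1 (PresentedGroup.generated_by (nnRels n)
    (Subgroup.centralizer {r n 0 * r n 2}) (fun i => Subgroup.mem_centralizer_singleton_iff.2
      (commute_r_zero_mul_r_two_r n i).eq.symm) g)).symm

theorem r_zero_mul_r_two_pow_two : (r n 0 * r n 2) ^ 2 = 1 := by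
  rw [Commute.mul_pow (r_zero_comm_r_two n), pow_two, pow_two, r_mul_self, r_mul_self, one_mul]

/-- Conjugation by the reflection `r₀` inverts the rotation `r₁r₂`. -/
theorem r_zero_conj_r_one_mul_r_two :
    r n 0 * (r n 1 * r n 2) * (r n 0)⁻¹ = (r n 1 * r n 2)⁻¹ := by
  have ha := r_zero_mul_r_one_mul_r_two_inv n
  rw [← mul_assoc, ← ha, ← mul_inv_rev, ← mul_assoc, ← mul_assoc, r_mul_self, one_mul]

end Relations

/-- The group of the map `{n,n}₂` maps onto a dihedral group times a group of order two. -/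
def NNGroup.toDihedralProd (n : ℕ) (hn : Even n) :
    NNGroup n →* DihedralGroup n × Multiplicative (ZMod 2) :=
  PresentedGroup.toGroup (rels := nnRels n)
    (f := ![(.sr 0, 1), (.sr (-1), .ofAdd 1), (.sr 0, .ofAdd 1)]) (by
      have h2 : (Multiplicative.ofAdd (1 : ZMod 2)) ^ 2 = 1 := rfl
      have h11 : (1 + 1 : ZMod 2) = 0 := rfl
      have h2n : (Multiplicative.ofAdd (1 : ZMod 2)) ^ n = 1 := by
        obtain ⟨k, rfl⟩ := hn
        rw [← two_mul, pow_mul, h2, one_pow]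
      simp only [nnRels, Set.mem_insert_iff, Set.mem_singleton_iff]
      rintro x (rfl | rfl | rfl | rfl | rfl | rfl | rfl) <;>
        simp [Prod.ext_iff, pow_two, h2n, ← DihedralGroup.r_zero, ← ofAdd_add, h11])

theorem NNGroup.toDihedralProd_r (n : ℕ) (hn : Even n) (i : Fin 3) :
    NNGroup.toDihedralProd n hn (r n i)
      = (![(.sr 0, 1), (.sr (-1), .ofAdd 1), (.sr 0, .ofAdd 1)] :
        Fin 3 → DihedralGroup n × Multiplicative (ZMod 2)) i :=
  PresentedGroup.toGroup.of _

/-- The inverse of `NNGroup.toDihedralProd`. -/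
def NNGroup.ofDihedralProd (n : ℕ) :
    DihedralGroup n × Multiplicative (ZMod 2) →* NNGroup n :=
  MonoidHom.noncommCoprod
    (DihedralGroup.lift n (r n 0) (r n 1 * r n 2) (r_mul_self n 0) (r_one_mul_r_two_pow n)
      (r_zero_conj_r_one_mul_r_two n))
    (zmodPowersHom 2 (r n 0 * r n 2) (r_zero_mul_r_two_pow_two n))
    (by
      intro x y
      obtain ⟨k, hk⟩ := ZMod.intCast_surjective y.toAdd
      rw [← ofAdd_toAdd y, ← hk, zmodPowersHom_ofAdd_intCast]
      exact ((commute_r_zero_mul_r_two n _).zpow_left k).symm)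

/-- The group of the map `{n,n}₂`, for even `n`, is a dihedral group times a group of
order two. -/
def NNGroup.equivDihedralProd (n : ℕ) (hn : Even n) :
    NNGroup n ≃* DihedralGroup n × Multiplicative (ZMod 2) :=
  MonoidHom.toMulEquiv (NNGroup.toDihedralProd n hn) (NNGroup.ofDihedralProd n)
    (by
      have h0 := DihedralGroup.lift_sr n (r n 0) (r n 1 * r n 2) (r_mul_self n 0)
        (r_one_mul_r_two_pow n) (r_zero_conj_r_one_mul_r_two n) 0
      have h1 := DihedralGroup.lift_sr n (r n 0) (r n 1 * r n 2) (r_mul_self n 0)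
        (r_one_mul_r_two_pow n) (r_zero_conj_r_one_mul_r_two n) (-1)
      have hz := zmodPowersHom_ofAdd_one 2 (r n 0 * r n 2) (r_zero_mul_r_two_pow_two n)
      simp only [Int.cast_zero, zpow_zero, mul_one] at h0
      simp only [Int.cast_neg, Int.cast_one, zpow_neg, zpow_one, mul_inv_rev, r_inv] at h1
      refine PresentedGroup.ext fun i => ?_
      change NNGroup.ofDihedralProd n (NNGroup.toDihedralProd n hn (r n i)) = r n i
      rw [NNGroup.toDihedralProd_r]
      fin_cases i
      · simp [NNGroup.ofDihedralProd, h0]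
      · simp only [NNGroup.ofDihedralProd, MonoidHom.noncommCoprod_apply]
        change DihedralGroup.lift n _ _ _ _ _ (.sr (-1)) * zmodPowersHom 2 _ _ (.ofAdd 1) = r n 1
        rw [h1, hz, ← mul_assoc (r n 0), (commute_r_zero_mul_r_two_r n 1).eq, mul_assoc, ← pow_two,
          r_zero_mul_r_two_pow_two, mul_one]
      · simp [NNGroup.ofDihedralProd, h0, hz, ← mul_assoc, r_mul_self])
    (by
      have hr0 : NNGroup.toDihedralProd n hn (r n 0) = (.sr 0, 1) :=
        NNGroup.toDihedralProd_r n hn 0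
      have hr1 : NNGroup.toDihedralProd n hn (r n 1) = (.sr (-1), .ofAdd 1) :=
        NNGroup.toDihedralProd_r n hn 1
      have hr2 : NNGroup.toDihedralProd n hn (r n 2) = (.sr 0, .ofAdd 1) :=
        NNGroup.toDihedralProd_r n hn 2
      have h11 : (1 + 1 : ZMod 2) = 0 := rfl
      ext ⟨x, y⟩ : 1
      obtain ⟨l, hl⟩ := ZMod.intCast_surjective y.toAdd
      obtain rfl : y = .ofAdd (l : ZMod 2) := by rw [hl, ofAdd_toAdd]
      rcases x with k | k <;> obtain ⟨k, rfl⟩ := ZMod.intCast_surjective k <;>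
        simp [NNGroup.ofDihedralProd, DihedralGroup.lift_r, DihedralGroup.lift_sr,
          zmodPowersHom_ofAdd_intCast, hr0, hr1, hr2, ← ofAdd_add, h11, ← ofAdd_zsmul])

theorem NNGroup.equivDihedralProd_apply (n : ℕ) (hn : Even n) (g : NNGroup n) :
    NNGroup.equivDihedralProd n hn g = NNGroup.toDihedralProd n hn g :=
  rfl

/-- For even `n = 2m` with `m ≥ 2`, the centraliser in `G` of the element
`a = r₀r₁r₂` has order 8. -/
theorem stmt12 (n m : ℕ) (hm : 2 ≤ m) (hn : n = 2 * m) :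
    Nat.card (Subgroup.centralizer {r n 0 * r n 1 * r n 2} : Subgroup (NNGroup n))
      = 8 := by
  subst hn
  have hf : NNGroup.equivDihedralProd (2 * m) (even_two_mul m)
      (r (2 * m) 0 * r (2 * m) 1 * r (2 * m) 2) = (.sr 1, 1) := by
    rw [NNGroup.equivDihedralProd_apply]
    have h11 : (1 + 1 : ZMod 2) = 0 := rfl
    simp [NNGroup.toDihedralProd_r, ← ofAdd_add, h11]
  rw [MulEquiv.card_centralizer_singleton (NNGroup.equivDihedralProd (2 * m) (even_two_mul m)),
    hf, Subgroup.card_centralizer_prod_one, DihedralGroup.card_centralizer_sr (by omega)]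
  simp
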